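/- Let d ≥ 2. There exists η > 0 such that for every integer k ≥ 10, if (t, u) is drawn from the uniform distribution on T × N and then X = (X₁, …, X_{d−1}) consists of d − 1 i.i.d. samples from G(1/k, t, u), then P( X ∈ C^{d−1} ) ≥ η, i.e., with probability at least η all d − 1 samples lie in the cylinder C. -/

import Mathlib

open MeasureTheory Real
open scoped RealInnerProductSpace ENNReal

namespace GaussLB

noncomputable section

/-- Euclidean space `ℝ^d`. -/
abbrev Euc (d : ℕ) := EuclideanSpace ℝ (Fin d)

/-- The last coordinate index of `Fin d`. -/
def lastIdx (d : ℕ) [NeZero d] : Fin d := ⟨d - 1, Nat.sub_lt (NeZero.pos d) one_pos⟩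

/-- The last standard basis vector `e_d` of `ℝ^d`. -/
def eLast (d : ℕ) [NeZero d] : Euc d := EuclideanSpace.single (lastIdx d) 1

/-- The disk `T = {(t,0) : t ∈ ℝ^{d−1}, ‖t‖ ≤ 1/2}`. -/
def diskT (d : ℕ) [NeZero d] : Set (Euc d) :=
  {x | x (lastIdx d) = 0 ∧ ‖x‖ ≤ 1/2}

/-- The cylinder `C = {(t,λ) : t ∈ ℝ^{d−1}, ‖t‖ ≤ 1/2, λ ∈ [1,2]}`. -/
def cylC (d : ℕ) [NeZero d] : Set (Euc d) :=
  {x | x (lastIdx d) ∈ Set.Icc (1:ℝ) 2 ∧ ‖x - x (lastIdx d) • eLast d‖ ≤ 1/2}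

/-- The spherical region `N = {u : ‖u‖ = 1, |u·e_d| ≤ √3/2}`. -/
def capN (d : ℕ) [NeZero d] : Set (Euc d) :=
  {u | ‖u‖ = 1 ∧ |⟪u, eLast d⟫| ≤ Real.sqrt 3 / 2}

/-- The Lebesgue density of the Gaussian `G(σ,t,u) = N(t, I_d − (1−σ²)·u uᵀ)`:
since `det Σ = σ²` and `Σ⁻¹ = I_d + (σ⁻² − 1)·u uᵀ`, it equals
`(2π)^{−d/2} σ⁻¹ exp(−(‖x−t‖² + (σ⁻²−1)⟪u, x−t⟫²)/2)`. -/
def gdens (d : ℕ) (σ : ℝ) (t u : Euc d) (x : Euc d) : ℝ :=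
  (2 * π) ^ (-(d:ℝ)/2) * σ⁻¹ *
    Real.exp (-(‖x - t‖^2 + ((σ^2)⁻¹ - 1) * ⟪u, x - t⟫^2) / 2)

/-- The Gaussian measure `G(σ,t,u) = N(t, I_d − (1−σ²)·u uᵀ)` on `ℝ^d`. -/
def gaussTU (d : ℕ) (σ : ℝ) (t u : Euc d) : Measure (Euc d) :=
  volume.withDensity fun x => ENNReal.ofReal (gdens d σ t u x)

/-- Normalization of a measure to a probability measure. -/
def normalize {Z : Type*} [MeasurableSpace Z] (μ : Measure Z) : Measure Z :=
  (μ Set.univ)⁻¹ • μ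

/-- The embedding `ℝ^{d−1} → ℝ^d` appending `0` as the last coordinate. -/
def emb (d : ℕ) : Euc (d-1) → Euc d := fun x =>
  (EuclideanSpace.equiv (Fin d) ℝ).symm
    (fun i => if h : (i : ℕ) < d - 1 then x ⟨i, h⟩ else 0)

/-- The uniform distribution on the disk `T`: the normalized `(d−1)`-dimensional
Lebesgue measure on the disk of radius `1/2`, embedded into the hyperplane of `ℝ^d`
spanned by the first `d−1` coordinates. -/
def uniformT (d : ℕ) : Measure (Euc d) :=
  normalize ((volume.restrict {x : Euc (d-1) | ‖x‖ ≤ 1/2}).map (emb d))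

/-- The uniform distribution on the spherical region `N`: the normalized cone
(surface) measure of `N`. -/
def uniformN (d : ℕ) [NeZero d] : Measure (Euc d) :=
  normalize ((volume.restrict
      {x : Euc d | 0 < ‖x‖ ∧ ‖x‖ ≤ 1 ∧ ‖x‖⁻¹ • x ∈ capN d}).map
    (fun x => ‖x‖⁻¹ • x))

/-- The uniform distribution on `T × N`. -/
def uniformTN (d : ℕ) [NeZero d] : Measure (Euc d × Euc d) :=
  (uniformT d).prod (uniformN d)

/-- Total variation distance between two measures. -/
def tv {Z : Type*} [MeasurableSpace Z] (p q : Measure Z) : ℝ :=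
  ⨆ B : {s : Set Z // MeasurableSet s}, |(p B).toReal - (q B).toReal|

end

lemma gdens_meas (d : ℕ) (σ : ℝ) (t u : Euc d) : Measurable (gdens d σ t u) := by
  unfold gdens
  fun_prop

lemma map_det (d : ℕ) (u : Euc d) (hu : ‖u‖ = 1) (s : ℝ) :
    ∃ A : Euc d →ₗ[ℝ] Euc d, (∀ y, A y = y - ((1 - s) * ⟪u, y⟫) • u) ∧ LinearMap.det A = s := by
  refine ⟨LinearMap.transvection ((-(1 - s)) • (innerₗ (Euc d) u)) u, ?_, ?_⟩
  · intro y
    simp only [LinearMap.transvection.apply, LinearMap.smul_apply, innerₗ_apply_apply, smul_eq_mul]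
    module
  · rw [LinearMap.transvection.det]
    simp [hu]

lemma coord_le (d : ℕ) (x : Euc d) (i : Fin d) : |x i| ≤ ‖x‖ := by
  simpa using PiLp.norm_apply_le x i

lemma norm_eLast (d : ℕ) [NeZero d] : ‖eLast d‖ = 1 := by simp [eLast]

lemma eLast_last (d : ℕ) [NeZero d] : eLast d (lastIdx d) = 1 := by simp [eLast]

lemma in_cyl (d : ℕ) [NeZero d] (t w : Euc d) (ht : t (lastIdx d) = 0) (ht' : ‖t‖ ≤ 1/8)
    (hw : ‖w‖ ≤ 3/32) : t + (3/2:ℝ) • eLast d + w ∈ cylC d := by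
  have h1 := abs_le.1 ((coord_le d w (lastIdx d)).trans hw)
  have h2 : (t + (3/2:ℝ) • eLast d + w) (lastIdx d) = 3/2 + w (lastIdx d) := by
    simp [ht, eLast_last]
  refine ⟨?_, ?_⟩
  · rw [h2]; constructor <;> linarith [h1.1, h1.2]
  · rw [h2]
    have : t + (3/2:ℝ) • eLast d + w - (3/2 + w (lastIdx d)) • eLast d
        = t + (w - w (lastIdx d) • eLast d) := by
      module
    rw [this]
    calc _ ≤ ‖t‖ + (‖w‖ + ‖w (lastIdx d) • eLast d‖) :=
          (norm_add_le _ _).trans (by gcongr; exact norm_sub_le _ _)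
      _ ≤ _ := by
          rw [norm_smul, norm_eLast, Real.norm_eq_abs]
          linarith [coord_le d w (lastIdx d)]

noncomputable def cst (d : ℕ) : ℝ≥0∞ :=
  ENNReal.ofReal ((2 * π) ^ (-(d:ℝ)/2) * Real.exp (-5)) * volume (Metric.ball (0 : Euc d) (1/32))

lemma cst_pos (d : ℕ) : cst d ≠ 0 := by
  unfold cst
  refine mul_ne_zero ?_ (Metric.measure_ball_pos _ _ (by norm_num)).ne'
  simp only [ne_eq, ENNReal.ofReal_eq_zero, not_le]
  positivity

lemma gauss_lower (d : ℕ) [NeZero d] (t u : Euc d) (ht : t (lastIdx d) = 0) (ht' : ‖t‖ ≤ 1/8)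
    (hu : ‖u‖ = 1) (hu' : |⟪u, eLast d⟫| ≤ 1/64) (k : ℕ) (hk : 10 ≤ k) :
    cst d ≤ gaussTU d (1/(k:ℝ)) t u (cylC d) := by
  have hk0 : (10:ℝ) ≤ k := by exact_mod_cast hk
  obtain ⟨s, hs⟩ : ∃ s : ℝ, s = 1/(k:ℝ) := ⟨_, rfl⟩
  have hs0 : 0 < s := by rw [hs]; positivity
  have hs1 : s ≤ 1 := by rw [hs, div_le_one (by linarith)]; linarith
  rw [← hs]
  clear hs hk0 hk
  obtain ⟨A, hA, hdet⟩ := map_det d u hu s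
  obtain ⟨a, ha⟩ : ∃ a : ℝ, a = ⟪u, eLast d⟫ := ⟨_, rfl⟩
  rw [← ha] at hu'
  set p : Euc d := t + (3/2:ℝ) • eLast d - ((3/2) * a) • u with hp
  set S : Set (Euc d) := (fun x => p + x) '' (A '' Metric.ball 0 (1/32)) with hS
  have hvol : volume S = ENNReal.ofReal s * volume (Metric.ball (0 : Euc d) (1/32)) := by
    rw [hS, Set.image_add_left, measure_preimage_add, Measure.addHaar_image_linearMap, hdet,
      abs_of_pos hs0]
  have key : ∀ x ∈ S, x ∈ cylC d ∧
      (2 * π) ^ (-(d:ℝ)/2) * Real.exp (-5) * s⁻¹ ≤ gdens d s t u x := by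
    rintro _ ⟨_, ⟨y, hy, rfl⟩, rfl⟩
    have hy' : ‖y‖ < 1/32 := by simpa using hy
    obtain ⟨b, hb⟩ : ∃ b : ℝ, b = ⟪u, y⟫ := ⟨_, rfl⟩
    have hb' : |b| ≤ 1/32 := by
      have := abs_real_inner_le_norm u y
      rw [hu, ← hb] at this
      linarith
    set w : Euc d := y - ((3/2) * a) • u - ((1 - s) * b) • u with hw
    have e1 : p + A y = t + (3/2:ℝ) • eLast d + w := by
      rw [hA, hp, hw, ← hb]; module
    have hwn : ‖w‖ ≤ 3/32 := by
      have h1 : ‖((3/2) * a) • u‖ ≤ 3/128 := by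
        rw [norm_smul, hu, Real.norm_eq_abs, abs_mul, abs_of_pos (by norm_num : (0:ℝ) < 3/2)]
        linarith
      have h2 : ‖((1 - s) * b) • u‖ ≤ 1/32 := by
        rw [norm_smul, hu, Real.norm_eq_abs, abs_mul, abs_of_nonneg (by linarith : (0:ℝ) ≤ 1 - s)]
        nlinarith [abs_nonneg b]
      have h3 := norm_sub_le (y - ((3/2) * a) • u) (((1 - s) * b) • u)
      have h4 := norm_sub_le y (((3/2) * a) • u)
      rw [hw]
      linarith
    simp only [e1]
    refine ⟨in_cyl d t w ht ht' hwn, ?_⟩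
    have e2 : t + (3/2:ℝ) • eLast d + w - t = (3/2:ℝ) • eLast d + w := by abel
    have e3 : ⟪u, (3/2:ℝ) • eLast d + w⟫ = s * b := by
      rw [hw]
      simp only [inner_add_right, inner_sub_right, inner_smul_right, ← ha, ← hb,
        real_inner_self_eq_norm_sq, hu]
      ring
    have e4 : ‖(3/2:ℝ) • eLast d + w‖ ≤ 2 := by
      refine (norm_add_le _ _).trans ?_
      rw [norm_smul, norm_eLast, Real.norm_eq_abs, abs_of_pos (by norm_num : (0:ℝ) < 3/2)]
      linarith
    unfold gdens
    rw [e2, e3, mul_right_comm]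
    gcongr
    have e5 : ((s^2)⁻¹ - 1) * (s * b)^2 = (1 - s^2) * b^2 := by
      field_simp
    rw [e5]
    have e6 : b^2 ≤ 1 := by
      rw [← sq_abs]; nlinarith [abs_nonneg b]
    have e7 : ‖(3/2:ℝ) • eLast d + w‖^2 ≤ 4 := by nlinarith [norm_nonneg ((3/2:ℝ) • eLast d + w)]
    nlinarith [mul_nonneg (sq_nonneg s) (sq_nonneg b)]
  have hSc : S ⊆ cylC d := fun x hx => (key x hx).1
  calc cst d = ENNReal.ofReal ((2 * π) ^ (-(d:ℝ)/2) * Real.exp (-5) * s⁻¹) * volume S := by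
        rw [hvol, ← mul_assoc, ← ENNReal.ofReal_mul (by positivity), mul_assoc,
          inv_mul_cancel₀ hs0.ne', mul_one, cst]
    _ = ∫⁻ x in S, ENNReal.ofReal ((2 * π) ^ (-(d:ℝ)/2) * Real.exp (-5) * s⁻¹) := by
        rw [setLIntegral_const]
    _ ≤ ∫⁻ x in S, ENNReal.ofReal (gdens d s t u x) :=
        setLIntegral_mono (gdens_meas d s t u).ennreal_ofReal
          (fun x hx => ENNReal.ofReal_le_ofReal (key x hx).2)
    _ ≤ gaussTU d s t u S := withDensity_apply_le _ _
    _ ≤ _ := measure_mono hSc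

lemma emb_cont (d : ℕ) : Continuous (emb d) := by
  unfold emb
  refine (EuclideanSpace.equiv (Fin d) ℝ).symm.continuous.comp ?_
  refine continuous_pi fun i => ?_
  split_ifs <;> fun_prop

lemma normalize_pos {Z : Type*} [MeasurableSpace Z] (μ : Measure Z) [IsFiniteMeasure μ] (s : Set Z)
    (h : μ s ≠ 0) : normalize μ s ≠ 0 := by
  unfold normalize
  simp [h]

def setA (d : ℕ) [NeZero d] : Set (Euc d) := {t | t (lastIdx d) = 0 ∧ ‖t‖ ≤ 1/8}
def setB (d : ℕ) [NeZero d] : Set (Euc d) := {u | ‖u‖ = 1 ∧ |⟪u, eLast d⟫| ≤ 1/64}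

lemma setA_meas (d : ℕ) [NeZero d] : MeasurableSet (setA d) :=
  MeasurableSet.inter (s₁ := {t : Euc d | t (lastIdx d) = 0}) (s₂ := {t : Euc d | ‖t‖ ≤ 1/8})
    (isClosed_eq (by fun_prop) (by fun_prop)).measurableSet
    (isClosed_le (by fun_prop) (by fun_prop)).measurableSet

lemma setB_meas (d : ℕ) [NeZero d] : MeasurableSet (setB d) :=
  MeasurableSet.inter (s₁ := {t : Euc d | ‖t‖ = 1}) (s₂ := {t : Euc d | |⟪t, eLast d⟫| ≤ 1/64})
    (isClosed_eq (by fun_prop) (by fun_prop)).measurableSet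
    (isClosed_le (by fun_prop) (by fun_prop)).measurableSet

lemma uniformT_pos (d : ℕ) [NeZero d] : uniformT d (setA d) ≠ 0 := by
  have : IsFiniteMeasure ((volume : Measure (Euc (d-1))).restrict
      {x : Euc (d-1) | ‖x‖ ≤ 1/2}) := by
    refine ⟨?_⟩
    rw [Measure.restrict_apply_univ]
    refine lt_of_le_of_lt (measure_mono ?_)
      (measure_closedBall_lt_top (x := (0 : Euc (d-1))) (r := 1/2))
    intro x hx
    simpa using hx
  unfold uniformT
  apply normalize_pos
  have h0 : emb d 0 = 0 := by
    ext i; simp [emb]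
  have hopen : IsOpen ({x : Euc (d-1) | ‖emb d x‖ < 1/8} ∩ {x | ‖x‖ < 1/2}) :=
    (isOpen_lt (emb_cont d).norm continuous_const).inter
      (isOpen_lt continuous_norm continuous_const)
  have hpos := hopen.measure_pos volume ⟨0, by simp [h0]⟩
  refine (hpos.trans_le ?_).ne'
  refine le_trans ?_ (Measure.le_map_apply (emb_cont d).measurable.aemeasurable _)
  refine le_trans (measure_mono ?_) (Measure.le_restrict_apply _ _)
  rintro x ⟨h1, h2⟩
  refine ⟨⟨?_, le_of_lt h1⟩, show ‖x‖ ≤ 1/2 from le_of_lt h2⟩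
  simp [emb, lastIdx]

lemma uniformN_pos (d : ℕ) [NeZero d] (hd : 2 ≤ d) : uniformN d (setB d) ≠ 0 := by
  have : IsFiniteMeasure ((volume : Measure (Euc d)).restrict
      {x : Euc d | 0 < ‖x‖ ∧ ‖x‖ ≤ 1 ∧ ‖x‖⁻¹ • x ∈ capN d}) := by
    refine ⟨?_⟩
    rw [Measure.restrict_apply_univ]
    refine lt_of_le_of_lt (measure_mono ?_)
      (measure_closedBall_lt_top (x := (0 : Euc d)) (r := 1))
    intro x hx
    simpa using hx.2.1
  unfold uniformN
  apply normalize_pos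
  have hopen : IsOpen ({x : Euc d | 0 < ‖x‖} ∩ ({x | ‖x‖ < 1} ∩
      {x | |⟪x, eLast d⟫| < ‖x‖ * (1/64)})) :=
    (isOpen_lt (by fun_prop) (by fun_prop)).inter ((isOpen_lt (by fun_prop) (by fun_prop)).inter
      (isOpen_lt (by fun_prop) (by fun_prop)))
  have hne : (⟨0, by omega⟩ : Fin d) ≠ lastIdx d := by
    simp only [lastIdx, ne_eq, Fin.mk.injEq]; omega
  have hpos := hopen.measure_pos volume
    ⟨EuclideanSpace.single (⟨0, by omega⟩ : Fin d) (1/2 : ℝ), by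
      have hx : ‖(EuclideanSpace.single (⟨0, by omega⟩ : Fin d) (1/2 : ℝ) : Euc d)‖ = 1/2 := by
        rw [EuclideanSpace.norm_single]; norm_num
      have hy : ⟪(EuclideanSpace.single (⟨0, by omega⟩ : Fin d) (1/2 : ℝ) : Euc d), eLast d⟫ = 0 := by
        rw [EuclideanSpace.inner_single_left, eLast, PiLp.single_apply, if_neg hne, mul_zero]
      refine ⟨?_, ?_, ?_⟩
      · show 0 < ‖_‖
        rw [hx]; norm_num
      · show ‖_‖ < 1
        rw [hx]; norm_num
      · show |_| < ‖_‖ * (1/64)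
        rw [hx, hy]; norm_num⟩
  refine (hpos.trans_le ?_).ne'
  have hm : Measurable (fun x : Euc d => ‖x‖⁻¹ • x) := by fun_prop
  refine le_trans ?_ (Measure.le_map_apply hm.aemeasurable _)
  refine le_trans (measure_mono ?_) (Measure.le_restrict_apply _ _)
  rintro x ⟨h1, h2, h3⟩
  simp only [Set.mem_ofPred_eq] at h1 h2 h3
  have hn : ‖‖x‖⁻¹ • x‖ = 1 := by
    rw [norm_smul, norm_inv, norm_norm, inv_mul_cancel₀ h1.ne']
  have hi : |⟪‖x‖⁻¹ • x, eLast d⟫| ≤ 1/64 := by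
    rw [real_inner_smul_left, abs_mul, abs_inv, abs_norm, inv_mul_le_iff₀ h1]
    exact h3.le
  refine ⟨⟨hn, hi⟩, h1, h2.le, hn, hi.trans ?_⟩
  have : (1:ℝ) ≤ √3 := Real.one_le_sqrt.2 (by norm_num)
  linarith

/-- **Claim 6.3**: for `d ≥ 2` there exists `η > 0` such that for every `k ≥ 10`, if
`(t,u)` is uniform on `T × N` and `X₁, …, X_{d−1}` are i.i.d. samples from `G(1/k,t,u)`,
then with probability at least `η` all `d − 1` samples lie in the cylinder `C`. -/
theorem samples_in_cylinder (d : ℕ) [NeZero d] (hd : 2 ≤ d) :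
    ∃ η : ℝ, 0 < η ∧ ∀ k : ℕ, 10 ≤ k →
      ENNReal.ofReal η ≤
        ∫⁻ tu, (Measure.pi fun _ : Fin (d-1) => gaussTU d (1/(k:ℝ)) tu.1 tu.2)
            {x | ∀ i, x i ∈ cylC d} ∂(uniformTN d) := by
  obtain ⟨η, h0, h1⟩ : ∃ η : ℝ, 0 < η ∧ ENNReal.ofReal η ≤
      cst d ^ (d-1) * uniformTN d (setA d ×ˢ setB d) := by
    have hK : cst d ^ (d-1) * uniformTN d (setA d ×ˢ setB d) ≠ 0 := by
      have : SFinite (uniformN d) := by unfold uniformN normalize; infer_instance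
      refine mul_ne_zero (pow_ne_zero _ (cst_pos d)) ?_
      rw [uniformTN, Measure.prod_prod]
      exact mul_ne_zero (uniformT_pos d) (uniformN_pos d hd)
    generalize cst d ^ (d-1) * uniformTN d (setA d ×ˢ setB d) = K at hK
    have hm : min K 1 ≠ ⊤ := by simp
    refine ⟨(min K 1).toReal, ENNReal.toReal_pos ?_ hm, ?_⟩
    · intro h
      rcases min_eq_iff.1 h with h | h
      · exact hK h.1
      · exact one_ne_zero h.1
    · rw [ENNReal.ofReal_toReal hm]
      exact min_le_left _ _
  refine ⟨η, h0, fun k hk => h1.trans ?_⟩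
  rw [← setLIntegral_const]
  refine le_trans (setLIntegral_mono' ((setA_meas d).prod (setB_meas d)) ?_)
    (setLIntegral_le_lintegral _ _)
  rintro ⟨t, u⟩ ⟨⟨ht, ht'⟩, hu, hu'⟩
  have : SigmaFinite (gaussTU d (1/(k:ℝ)) t u) := by
    unfold gaussTU
    exact SigmaFinite.withDensity_ofReal _
  have hset : {x : Fin (d-1) → Euc d | ∀ i, x i ∈ cylC d} = Set.pi Set.univ fun _ => cylC d := by
    ext x; simp
  simp only
  rw [hset, Measure.pi_pi]
  simp only [Finset.prod_const, Finset.card_univ, Fintype.card_fin]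
  gcongr
  exact gauss_lower d t u ht ht' hu hu' k hk

end GaussLB
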